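/- (Segre type [(11)13]) Let n = 3 with coordinates (u¹,u²,u³), let λ be a nonzero real constant, define the symmetric metric g by g₁₁ = 2u³ − 2λ(u³)², g₁₂ = −1 − 2λu³, g₁₃ = −u¹ + λu² + 2λu¹u³, g₂₂ = −2λ, g₂₃ = λu¹, g₃₃ = −2λ(u¹)², and let U = {u ∈ ℝ³ : det g(u) < 0}. Define c_{ijk} := (1/3)(∂_j g_{ik} − ∂_k g_{ij}) and the skew-symmetric field w by w₁₂ = 0, w₂₃ = √3 λ² u¹/√(−det g), w₃₁ = √3 λ² u²/√(−det g) (with w_{ji} = −w_{ij}, w_{ii} = 0). Then (g, c, w) satisfies conditions (cond1) on U. -/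

import Mathlib

open scoped BigOperators

/-- Partial derivative `∂_k f` in the `k`-th coordinate direction. -/
noncomputable def pd {n : ℕ} (k : Fin n) (f : (Fin n → ℝ) → ℝ) (u : Fin n → ℝ) : ℝ :=
  fderiv ℝ f u (Pi.single k 1)

/-- Conditions (cond1) for a triple `(g, c, w)` on a set `U ⊆ ℝⁿ`:
`g` is the (lower-index) metric `g_{ij}`, `c` are the lowered coefficients `c_{ijk}`,
`w` is the skew-symmetric 2-form `w_{ij}`, and `c^s_{jk} := g^{si} c_{ijk}` is computed
via the pointwise inverse matrix `(g u)⁻¹`. -/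
def Cond1 {n : ℕ} (U : Set (Fin n → ℝ))
    (g : (Fin n → ℝ) → Matrix (Fin n) (Fin n) ℝ)
    (c : (Fin n → ℝ) → Fin n → Fin n → Fin n → ℝ)
    (w : (Fin n → ℝ) → Matrix (Fin n) (Fin n) ℝ) : Prop :=
  ∀ u ∈ U,
    (∀ i j k, pd k (fun x => g x i j) u + c u i j k + c u j i k = 0) ∧
    (∀ i j k, c u i j k + c u i k j = 0) ∧
    (∀ i j k, pd k (fun x => g x i j) u + pd i (fun x => g x j k) u
        + pd j (fun x => g x k i) u = 0) ∧
    (∀ i j, w u i j + w u j i = 0) ∧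
    (∀ i j l, pd l (fun x => w x i j) u
        = ∑ s, (∑ a, (g u)⁻¹ s a * c u a i j) * w u s l) ∧
    (∀ m l p k, pd k (fun x => c x p m l) u
        + ∑ s, (∑ a, (g u)⁻¹ s a * c u a m l) * c u s p k + w u m l * w u p k = 0)

lemma pd_const' {n : ℕ} (k : Fin n) (a : ℝ) (u : Fin n → ℝ) : pd k (fun _ => a) u = 0 := by
  simp [pd]

lemma pd_coord {n : ℕ} (k i : Fin n) (u : Fin n → ℝ) :
    pd k (fun x => x i) u = if i = k then 1 else 0 := by
  have h : HasFDerivAt (fun x : Fin n → ℝ => x i)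
      (ContinuousLinearMap.proj (R := ℝ) (φ := fun _ : Fin n => ℝ) i) u :=
    (ContinuousLinearMap.proj (R := ℝ) (φ := fun _ : Fin n => ℝ) i).hasFDerivAt
  rw [pd, h.fderiv]
  simp [Pi.single_apply]

lemma pd_add' {n : ℕ} (k : Fin n) (f h : (Fin n → ℝ) → ℝ) (u : Fin n → ℝ)
    (hf : DifferentiableAt ℝ f u) (hh : DifferentiableAt ℝ h u) :
    pd k (fun x => f x + h x) u = pd k f u + pd k h u := by
  rw [pd, fderiv_fun_add hf hh]; rfl

lemma pd_sub' {n : ℕ} (k : Fin n) (f h : (Fin n → ℝ) → ℝ) (u : Fin n → ℝ)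
    (hf : DifferentiableAt ℝ f u) (hh : DifferentiableAt ℝ h u) :
    pd k (fun x => f x - h x) u = pd k f u - pd k h u := by
  rw [pd, fderiv_fun_sub hf hh]; rfl

lemma pd_neg' {n : ℕ} (k : Fin n) (f : (Fin n → ℝ) → ℝ) (u : Fin n → ℝ) :
    pd k (fun x => - f x) u = - pd k f u := by
  rw [pd, fderiv_fun_neg]; rfl

lemma pd_mul' {n : ℕ} (k : Fin n) (f h : (Fin n → ℝ) → ℝ) (u : Fin n → ℝ)
    (hf : DifferentiableAt ℝ f u) (hh : DifferentiableAt ℝ h u) :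
    pd k (fun x => f x * h x) u = f u * pd k h u + h u * pd k f u := by
  rw [pd, fderiv_fun_mul hf hh]; rfl

lemma pd_sq {n : ℕ} (k : Fin n) (f : (Fin n → ℝ) → ℝ) (u : Fin n → ℝ)
    (hf : DifferentiableAt ℝ f u) :
    pd k (fun x => f x ^ 2) u = 2 * f u * pd k f u := by
  simp only [pow_two]
  rw [pd_mul' k f f u hf hf]; ring

/-- Derivative of `f / √(-D)`. -/
lemma pd_div_sqrt {n : ℕ} (k : Fin n) (f D : (Fin n → ℝ) → ℝ) (u : Fin n → ℝ)
    (hf : DifferentiableAt ℝ f u) (hD : DifferentiableAt ℝ D u) (hneg : D u < 0) :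
    pd k (fun x => f x / Real.sqrt (-D x)) u
      = (pd k f u - f u * pd k D u / (2 * D u)) / Real.sqrt (-D u) := by
  have hpos : 0 < Real.sqrt (-D u) := Real.sqrt_pos.mpr (by linarith)
  have hne : -D u ≠ 0 := by linarith
  have hs := (hD.hasFDerivAt.fun_neg).sqrt hne
  have hq : Real.sqrt (-D u) ^ 2 = -D u := Real.sq_sqrt (by linarith)
  have hdiff : DifferentiableAt ℝ (fun x => Real.sqrt (-D x)) u := hs.differentiableAt
  have hd : pd k (fun x => Real.sqrt (-D x)) u = - pd k D u / (2 * Real.sqrt (-D u)) := by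
    rw [pd, hs.fderiv]
    simp [pd]
    ring
  have hquot : DifferentiableAt ℝ (fun x => f x / Real.sqrt (-D x)) u :=
    by
    simp only [div_eq_mul_inv]
    exact hf.fun_mul (hdiff.fun_inv hpos.ne')
  have hev : f =ᶠ[nhds u] fun x => (f x / Real.sqrt (-D x)) * Real.sqrt (-D x) := by
    have : ∀ᶠ x in nhds u, Real.sqrt (-D x) ≠ 0 := hdiff.continuousAt.eventually_ne hpos.ne'
    filter_upwards [this] with x hx
    field_simp
  have hprod : pd k f u = pd k (fun x => (f x / Real.sqrt (-D x)) * Real.sqrt (-D x)) u := by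
    rw [pd, pd, hev.fderiv_eq]
  rw [pd_mul' k _ _ u hquot hdiff, hd] at hprod
  rw [hprod, eq_div_iff hpos.ne']
  have hDe : D u = - Real.sqrt (-D u) ^ 2 := by linarith
  have hrw : f u * pd k D u / (2 * D u) = - (f u * pd k D u / (2 * Real.sqrt (-D u) ^ 2)) := by
    rw [hq]
    have : D u ≠ 0 := hneg.ne
    field_simp
  rw [hrw]
  field_simp
  ring

/-- The metric. -/
noncomputable def gM (l : ℝ) (u : Fin 3 → ℝ) : Matrix (Fin 3) (Fin 3) ℝ :=
  !![2 * u 2 - 2 * l * (u 2) ^ 2, -1 - 2 * l * u 2,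
           -(u 0) + l * u 1 + 2 * l * u 0 * u 2;
         -1 - 2 * l * u 2, -(2 * l), l * u 0;
         -(u 0) + l * u 1 + 2 * l * u 0 * u 2, l * u 0, -(2 * l * (u 0) ^ 2)]

/-- Derivatives of the metric. -/
noncomputable def dgM (l : ℝ) (u : Fin 3 → ℝ) (k : Fin 3) : Matrix (Fin 3) (Fin 3) ℝ :=
  if k = 0 then !![0, 0, -1 + 2 * l * u 2; 0, 0, l; -1 + 2 * l * u 2, l, -(4 * l * u 0)]
  else if k = 1 then !![0, 0, l; 0, 0, 0; l, 0, 0]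
  else !![2 - 4 * l * u 2, -(2 * l), 2 * l * u 0; -(2 * l), 0, 0; 2 * l * u 0, 0, 0]

/-- Determinant of the metric. -/
noncomputable def dP (l : ℝ) (u : Fin 3 → ℝ) : ℝ :=
  (6 * l + 6 * l ^ 2 * u 2 + 2 * l ^ 3 * u 2 ^ 2) * u 0 ^ 2
    + (4 * l ^ 3 * u 2 - 6 * l ^ 2) * (u 0 * u 1) + 2 * l ^ 3 * u 1 ^ 2

lemma gM_det (l : ℝ) (u : Fin 3 → ℝ) : (gM l u).det = dP l u := by
  simp [gM, dP, Matrix.det_fin_three]; ring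

lemma pd_gM (l : ℝ) (u : Fin 3 → ℝ) (i j k : Fin 3) :
    pd k (fun x => gM l x i j) u = dgM l u k i j := by
  fin_cases i <;> fin_cases j <;> fin_cases k <;>
    simp [gM, dgM] <;> (try simp (disch := fun_prop) only [pd_add', pd_sub', pd_neg', pd_mul', pd_sq, pd_const',
      pd_coord]) <;> (try simp) <;> (try ring)

/-- Derivatives of the determinant. -/
noncomputable def ddP (l : ℝ) (u : Fin 3 → ℝ) (k : Fin 3) : ℝ :=
  ![2 * (6 * l + 6 * l ^ 2 * u 2 + 2 * l ^ 3 * u 2 ^ 2) * u 0 + (4 * l ^ 3 * u 2 - 6 * l ^ 2) * u 1,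
    (4 * l ^ 3 * u 2 - 6 * l ^ 2) * u 0 + 4 * l ^ 3 * u 1,
    (6 * l ^ 2 + 4 * l ^ 3 * u 2) * u 0 ^ 2 + 4 * l ^ 3 * (u 0 * u 1)] k

lemma pd_dP (l : ℝ) (u : Fin 3 → ℝ) (k : Fin 3) : pd k (dP l) u = ddP l u k := by
  unfold dP
  fin_cases k <;>
    simp [ddP] <;> (try simp (disch := fun_prop) only [pd_add', pd_sub', pd_neg', pd_mul', pd_sq, pd_const',
      pd_coord]) <;> (try simp) <;> (try ring)

lemma dP_diff (l : ℝ) (u : Fin 3 → ℝ) : DifferentiableAt ℝ (dP l) u := by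
  unfold dP; fun_prop

/-- The coefficients `c`. -/
noncomputable def cM (l : ℝ) (u : Fin 3 → ℝ) (i j k : Fin 3) : ℝ :=
  (1 / 3) * (dgM l u j i k - dgM l u k i j)

/-- Constant second derivatives of the metric. -/
noncomputable def ddgM (l : ℝ) (k m i j : Fin 3) : ℝ :=
  if k = 0 ∧ m = 0 ∧ i = 2 ∧ j = 2 then -(4 * l)
  else if k = 2 ∧ m = 2 ∧ i = 0 ∧ j = 0 then -(4 * l)
  else if k = 0 ∧ m = 2 ∧ i = 0 ∧ j = 2 then 2 * l
  else if k = 0 ∧ m = 2 ∧ i = 2 ∧ j = 0 then 2 * l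
  else if k = 2 ∧ m = 0 ∧ i = 0 ∧ j = 2 then 2 * l
  else if k = 2 ∧ m = 0 ∧ i = 2 ∧ j = 0 then 2 * l
  else 0

lemma pd_dgM (l : ℝ) (u : Fin 3 → ℝ) (m i j k : Fin 3) :
    DifferentiableAt ℝ (fun x => dgM l x m i j) u ∧
    pd k (fun x => dgM l x m i j) u = ddgM l k m i j := by
  constructor
  · fin_cases i <;> fin_cases j <;> fin_cases m <;> simp [dgM] <;> fun_prop
  · fin_cases i <;> fin_cases j <;> fin_cases m <;> fin_cases k <;>
    simp [dgM, ddgM] <;> (try simp (disch := fun_prop) only [pd_add', pd_sub', pd_neg', pd_mul', pd_sq, pd_const',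
      pd_coord]) <;> (try simp) <;> (try ring)

lemma pd_cM (l : ℝ) (u : Fin 3 → ℝ) (i j k m : Fin 3) :
    pd m (fun x => cM l x i j k) u = (1 / 3) * (ddgM l m j i k - ddgM l m k i j) := by
  unfold cM
  have h1 := pd_dgM l u j i k m
  have h2 := pd_dgM l u k i j m
  rw [pd_mul' m _ _ u (differentiableAt_const _) (h1.1.fun_sub h2.1), pd_sub' m _ _ u h1.1 h2.1, pd_const',
    h1.2, h2.2]
  ring

/-- Adjugate of the metric. -/
noncomputable def aM (l : ℝ) (u : Fin 3 → ℝ) : Matrix (Fin 3) (Fin 3) ℝ := (gM l u).adjugate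

lemma gM_inv (l : ℝ) (u : Fin 3 → ℝ) (s a : Fin 3) :
    (gM l u)⁻¹ s a = aM l u s a / dP l u := by
  rw [Matrix.inv_def, gM_det]
  simp [aM, div_eq_inv_mul]

/-- The numerator of `w`. -/
noncomputable def wN (u : Fin 3 → ℝ) : Matrix (Fin 3) (Fin 3) ℝ :=
  !![0, 0, -u 1; 0, 0, u 0; u 1, -u 0, 0]

/-- Derivative of the numerator of `w`. -/
noncomputable def dwN (k : Fin 3) : Matrix (Fin 3) (Fin 3) ℝ :=
  if k = 0 then !![0, 0, 0; 0, 0, 1; 0, -1, 0]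
  else if k = 1 then !![0, 0, -1; 0, 0, 0; 1, 0, 0]
  else !![0, 0, 0; 0, 0, 0; 0, 0, 0]

lemma pd_wN (u : Fin 3 → ℝ) (i j k : Fin 3) :
    DifferentiableAt ℝ (fun x => wN x i j) u ∧ pd k (fun x => wN x i j) u = dwN k i j := by
  constructor
  · fin_cases i <;> fin_cases j <;> simp [wN] <;> fun_prop
  · fin_cases i <;> fin_cases j <;> fin_cases k <;> simp [wN, dwN, pd_neg', pd_const', pd_coord]

set_option maxHeartbeats 4000000 in
lemma key5 (l : ℝ) (u : Fin 3 → ℝ) (i j k : Fin 3) :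
    2 * dP l u * dwN k i j - wN u i j * ddP l u k
      = 2 * ∑ s, (∑ a, aM l u s a * cM l u a i j) * wN u s k := by
  simp only [Fin.sum_univ_three]
  fin_cases i <;> fin_cases j <;> fin_cases k <;>
    simp [dP, ddP, dwN, wN, aM, cM, dgM, gM, Matrix.adjugate_fin_three] <;> ring

set_option maxHeartbeats 4000000 in
lemma key6 (l : ℝ) (u : Fin 3 → ℝ) (m q p k : Fin 3) :
    dP l u * ((1 / 3) * (ddgM l k m p q - ddgM l k q p m))
      + ∑ s, (∑ a, aM l u s a * cM l u a m q) * cM l u s p k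
      - 3 * l ^ 4 * (wN u m q * wN u p k) = 0 := by
  simp only [Fin.sum_univ_three]
  fin_cases m <;> fin_cases q <;> fin_cases p <;> fin_cases k <;>
    simp [dP, ddgM, wN, aM, cM, dgM, gM, Matrix.adjugate_fin_three] <;> ring

/-- Segre type [(11)13]. With `(u¹,u²,u³) = (u 0, u 1, u 2)`, `λ ≠ 0`,
metric as indicated, `U = {u : det g(u) < 0}`, `c_{ijk} = (1/3)(∂_j g_{ik} − ∂_k g_{ij})`
and the skew form with `w₁₂ = 0`, `w₂₃ = √3 λ²u¹/√(−det g)`, `w₃₁ = √3 λ²u²/√(−det g)`,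
conditions (cond1) hold on `U`. -/
theorem segre_1113_second_satisfies_cond1 (l : ℝ) (hl : l ≠ 0)
    (g : (Fin 3 → ℝ) → Matrix (Fin 3) (Fin 3) ℝ)
    (hg : g = fun u =>
      !![2 * u 2 - 2 * l * (u 2) ^ 2, -1 - 2 * l * u 2,
           -(u 0) + l * u 1 + 2 * l * u 0 * u 2;
         -1 - 2 * l * u 2, -(2 * l), l * u 0;
         -(u 0) + l * u 1 + 2 * l * u 0 * u 2, l * u 0, -(2 * l * (u 0) ^ 2)])
    (U : Set (Fin 3 → ℝ)) (hU : U = {u | (g u).det < 0})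
    (c : (Fin 3 → ℝ) → Fin 3 → Fin 3 → Fin 3 → ℝ)
    (hc : c = fun u i j k =>
      (1 / 3) * (pd j (fun x => g x i k) u - pd k (fun x => g x i j) u))
    (w : (Fin 3 → ℝ) → Matrix (Fin 3) (Fin 3) ℝ)
    (hw : w = fun u =>
      !![0, 0, -(Real.sqrt 3 * l ^ 2 * u 1 / Real.sqrt (-(g u).det));
         0, 0, Real.sqrt 3 * l ^ 2 * u 0 / Real.sqrt (-(g u).det);
         Real.sqrt 3 * l ^ 2 * u 1 / Real.sqrt (-(g u).det),
           -(Real.sqrt 3 * l ^ 2 * u 0 / Real.sqrt (-(g u).det)), 0]) :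
    Cond1 U g c w := by
  have hg' : g = gM l := hg
  have hdet : ∀ x, (g x).det = dP l x := fun x => by rw [hg', gM_det]
  have hc' : c = cM l := by
    subst hc; funext u i j k; simp only [hg', pd_gM, cM]
  have hw' : w = fun u => (fun i j => Real.sqrt 3 * l ^ 2 * wN u i j / Real.sqrt (-dP l u)) := by
    subst hw; funext u i j
    simp only [hdet]
    fin_cases i <;> fin_cases j <;> simp [wN] <;> ring
  clear hg hc hw
  subst hg' hc' hw' hU
  intro u hu
  have hD : dP l u < 0 := by rw [← hdet]; exact hu
  have hD0 : dP l u ≠ 0 := hD.ne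
  have hpos : 0 < Real.sqrt (-dP l u) := Real.sqrt_pos.mpr (by linarith)
  have hq : Real.sqrt (-dP l u) ^ 2 = -dP l u := Real.sq_sqrt (by linarith)
  have h3 : Real.sqrt 3 ^ 2 = 3 := Real.sq_sqrt (by norm_num)
  refine ⟨?_, ?_, ?_, ?_, ?_, ?_⟩
  · intro i j k
    simp only [pd_gM, cM]
    fin_cases i <;> fin_cases j <;> fin_cases k <;> simp [dgM] <;> ring
  · intro i j k
    simp only [cM]; ring
  · intro i j k
    simp only [pd_gM]
    fin_cases i <;> fin_cases j <;> fin_cases k <;> simp [dgM] <;> ring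
  · intro i j
    fin_cases i <;> fin_cases j <;> simp [wN] <;> ring
  · intro i j k
    have hN := pd_wN u i j k
    have hm : pd k (fun x => Real.sqrt 3 * l ^ 2 * wN x i j) u
        = Real.sqrt 3 * l ^ 2 * dwN k i j := by
      rw [pd_mul' k _ _ u (differentiableAt_const _) hN.1, pd_const', hN.2]; ring
    rw [pd_div_sqrt k _ (dP l) u (hN.1.const_mul _) (dP_diff l u) hD, hm, pd_dP]
    have h5 := key5 l u i j k
    simp only [gM_inv]
    have e : ∑ s, (∑ a, aM l u s a / dP l u * cM l u a i j)
          * (Real.sqrt 3 * l ^ 2 * wN u s k / Real.sqrt (-dP l u))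
        = (Real.sqrt 3 * l ^ 2 / (2 * dP l u * Real.sqrt (-dP l u)))
          * (2 * ∑ s, (∑ a, aM l u s a * cM l u a i j) * wN u s k) := by
      simp only [Fin.sum_univ_three]; field_simp
    rw [e, ← h5]
    field_simp
  · intro m q p k
    have h6 := key6 l u m q p k
    rw [pd_cM]
    simp only [gM_inv]
    have e : ∑ s, (∑ a, aM l u s a / dP l u * cM l u a m q) * cM l u s p k
        = (∑ s, (∑ a, aM l u s a * cM l u a m q) * cM l u s p k) / dP l u := by
      simp only [Fin.sum_univ_three]; field_simp
    have e2 : (Real.sqrt 3 * l ^ 2 * wN u m q / Real.sqrt (-dP l u))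
        * (Real.sqrt 3 * l ^ 2 * wN u p k / Real.sqrt (-dP l u))
        = - (3 * l ^ 4 * (wN u m q * wN u p k)) / dP l u := by
      rw [div_mul_div_comm, ← pow_two (Real.sqrt (-dP l u)), hq]
      rw [div_eq_div_iff (by linarith) hD0]
      linear_combination (l ^ 4 * wN u m q * wN u p k * dP l u) * h3
    rw [e, e2]
    have : ∀ A B C : ℝ, dP l u * A + B - C = 0 → A + B / dP l u + -C / dP l u = 0 := by
      intro A B C h
      field_simp
      linarith
    exact this _ _ _ h6
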